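/- Let M be the exponent matrix of the loop polynomial with exponents a_1, …, a_N, and suppose N is odd. Then there is no integer vector r ∈ ℤ^N with 0 ≤ r_i ≤ a_i − 1 for all i such that M⁻¹(r + 𝟙) has all entries in ℤ (where 𝟙 = (1, …, 1)ᵀ). -/

import Mathlib

/-- The exponent matrix (over `ℚ`) of the loop polynomial with exponents `a`:
`M i i = a i`, `M i (i+1) = 1` (indices mod `N`), all other entries `0`. -/
def loopMatrixQ (N : ℕ) [NeZero N] (a : Fin N → ℤ) : Matrix (Fin N) (Fin N) ℚ :=
  Matrix.of fun i j => if j = i then (a i : ℚ) else if j = i + 1 then 1 else 0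

theorem Fin.add_one_ne_self {N : ℕ} [NeZero N] (hN : 2 ≤ N) (i : Fin N) : i + 1 ≠ i := by
  intro h
  have h1 : (1 : Fin N) = 0 := by simpa using h
  have h2 := congrArg Fin.val h1
  rw [Fin.val_one', Fin.val_zero, Nat.mod_eq_of_lt (by lia)] at h2
  lia

theorem loopMatrixQ_self {N : ℕ} [NeZero N] (a : Fin N → ℤ) (i : Fin N) :
    loopMatrixQ N a i i = a i := by
  simp [loopMatrixQ]

theorem loopMatrixQ_of_ne {N : ℕ} [NeZero N] (a : Fin N → ℤ) {i j : Fin N} (h : j ≠ i) :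
    loopMatrixQ N a i j = if j = i + 1 then 1 else 0 := by
  simp [loopMatrixQ, h]

theorem loopMatrixQ_mulVec {N : ℕ} [NeZero N] (hN : 2 ≤ N) (a : Fin N → ℤ) (v : Fin N → ℚ)
    (i : Fin N) : (loopMatrixQ N a).mulVec v i = a i * v i + v (i + 1) := by
  rw [Matrix.mulVec, dotProduct, ← Finset.add_sum_erase _ _ (Finset.mem_univ i), loopMatrixQ_self,
    Finset.sum_eq_single_of_mem (i + 1)
      (Finset.mem_erase.2 ⟨Fin.add_one_ne_self hN i, Finset.mem_univ _⟩),
    loopMatrixQ_of_ne a (Fin.add_one_ne_self hN i), if_pos rfl, one_mul]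
  intro j hj hne
  rw [loopMatrixQ_of_ne a (Finset.ne_of_mem_erase hj), if_neg hne, zero_mul]

/-- A loop matrix with all exponents at least two is strictly diagonally dominant. -/
theorem loopMatrixQ_det_ne_zero {N : ℕ} [NeZero N] (a : Fin N → ℤ) (ha : ∀ i, 2 ≤ a i) :
    (loopMatrixQ N a).det ≠ 0 := by
  refine det_ne_zero_of_sum_row_lt_diag fun i => ?_
  have hdiag : (2 : ℝ) ≤ ‖loopMatrixQ N a i i‖ := by
    rw [loopMatrixQ_self, ← Rat.norm_cast_real, Real.norm_eq_abs]
    exact le_trans (by exact_mod_cast ha i) (le_abs_self _)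
  have hoff : ∑ j ∈ Finset.univ.erase i, ‖loopMatrixQ N a i j‖ ≤ 1 :=
    calc ∑ j ∈ Finset.univ.erase i, ‖loopMatrixQ N a i j‖
        = ∑ j ∈ Finset.univ.erase i, if j = i + 1 then (1 : ℝ) else 0 := by
          refine Finset.sum_congr rfl fun j hj => ?_
          rw [loopMatrixQ_of_ne a (Finset.ne_of_mem_erase hj)]
          split_ifs <;> simp
      _ ≤ 1 := by
          rw [Finset.sum_ite_eq']
          split_ifs <;> norm_num
  linarith

theorem Fin.not_alternating_of_odd {N : ℕ} [NeZero N] (hN : Odd N) (p : Fin N → Prop) :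
    ¬ ∀ i, p (i + 1) ↔ ¬ p i := by
  intro h
  have key : ∀ k : ℕ, p (k • 1) ↔ (p 0 ↔ Even k) := by
    intro k
    induction k with
    | zero => simp
    | succ k ih =>
      rw [succ_nsmul, h, ih, Nat.even_add_one]
      tauto
  have hN1 : N • (1 : Fin N) = 0 := by
    simpa using card_nsmul_eq_zero' (x := (1 : Fin N))
  have := key N
  rw [hN1] at this
  have := Nat.not_even_iff_odd.2 hN
  tauto

/-- For an odd-variable loop, the identity symmetry cannot be written in the form
`M⁻¹ (r + 𝟙)` with `0 ≤ r i ≤ a i - 1`: no such `r` makes `M⁻¹ (r + 𝟙)` an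
integer vector. -/
theorem loop_odd_no_identity_representation (N : ℕ) [NeZero N] (hN : 3 ≤ N)
    (hNodd : Odd N) (a : Fin N → ℤ) (ha : ∀ i, 2 ≤ a i) :
    ¬ ∃ r : Fin N → ℤ, (∀ i, 0 ≤ r i ∧ r i ≤ a i - 1) ∧
      ∀ i : Fin N, ∃ z : ℤ,
        ((loopMatrixQ N a)⁻¹.mulVec (fun j => (r j : ℚ) + 1)) i = z := by
  rintro ⟨r, hr, hint⟩
  choose z hz using hint
  have hrec : ∀ i, a i * z i + z (i + 1) = r i + 1 := by
    intro i
    have hdet : IsUnit (loopMatrixQ N a).det := (loopMatrixQ_det_ne_zero a ha).isUnit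
    have hv : (loopMatrixQ N a).mulVec (fun i => (z i : ℚ)) = fun j => (r j : ℚ) + 1 := by
      rw [← funext hz, Matrix.mulVec_mulVec, Matrix.mul_nonsing_inv _ hdet, Matrix.one_mulVec]
    have hi := congrFun hv i
    rw [loopMatrixQ_mulVec (by lia)] at hi
    exact_mod_cast hi
  refine Fin.not_alternating_of_odd hNodd (fun i => 1 ≤ z i) fun i => ?_
  have h1 := hrec i
  have h2 := ha i
  obtain ⟨h3, h4⟩ := hr i
  constructor
  · intro h h'
    nlinarith
  · intro h
    nlinarith
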